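/- There exist two irreducible homogeneous cubic polynomials F, G ∈ ℂ[x,y,z] such that: (i) each of the curves V(F) and V(G) has exactly one singular point, and that singular point is a node; (ii) the zero loci intersect in exactly one point of ℙ², i.e. V(F) ∩ V(G) = {P} for some point P; and (iii) P is distinct from the node of V(F) and from the node of V(G) (so P is a smooth point of both cubics). -/

import Mathlib

noncomputable section

open MvPolynomial

/-- the complex projective plane -/
abbrev P2 := Projectivization ℂ (Fin 3 → ℂ)

instance : TopologicalSpace P2 :=
  inferInstanceAs (TopologicalSpace (Quotient (projectivizationSetoid ℂ (Fin 3 → ℂ))))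

/-- the zero locus in ℙ² of a homogeneous polynomial F: the set of points all of whose
representative vectors are zeros of F -/
def VV (F : MvPolynomial (Fin 3) ℂ) : Set P2 :=
  {P | ∀ (v : Fin 3 → ℂ) (h : v ≠ 0), Projectivization.mk ℂ v h = P → eval v F = 0}

/-- the singular locus of the curve {F = 0}: points at which all three partial
derivatives of F vanish (at every representative vector) -/
def SingLoc (F : MvPolynomial (Fin 3) ℂ) : Set P2 :=
  {P | ∀ (v : Fin 3 → ℂ) (h : v ≠ 0), Projectivization.mk ℂ v h = P →
    ∀ i : Fin 3, eval v (pderiv i F) = 0}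

/-- the conic F₁ = 8z²−20yz+36xz+17y²−18xy -/
def F₁ : MvPolynomial (Fin 3) ℂ :=
  8 * X 2 ^ 2 - 20 * X 1 * X 2 + 36 * X 0 * X 2 + 17 * X 1 ^ 2 - 18 * X 0 * X 1

/-- the quartic Q₁ = 8x²z²−16xy²z+52x²yz−36x³z−37x²y²+18x³y−y⁴+20xy³ -/
def Q₁ : MvPolynomial (Fin 3) ℂ :=
  8 * X 0 ^ 2 * X 2 ^ 2 - 16 * X 0 * X 1 ^ 2 * X 2 + 52 * X 0 ^ 2 * X 1 * X 2
    - 36 * X 0 ^ 3 * X 2 - 37 * X 0 ^ 2 * X 1 ^ 2 + 18 * X 0 ^ 3 * X 1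
    - X 1 ^ 4 + 20 * X 0 * X 1 ^ 3

/-- the conic F₂ = 3x²+2xy+108z² -/
def F₂ : MvPolynomial (Fin 3) ℂ :=
  3 * X 0 ^ 2 + 2 * X 0 * X 1 + 108 * X 2 ^ 2

/-- the quartic Q₂ = 2xy³+3x²y²+108y²z²−x⁴ -/
def Q₂ : MvPolynomial (Fin 3) ℂ :=
  2 * X 0 * X 1 ^ 3 + 3 * X 0 ^ 2 * X 1 ^ 2 + 108 * X 1 ^ 2 * X 2 ^ 2 - X 0 ^ 4

/-- gradient vector of F at the point v ∈ ℂ³ -/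
def gradP (F : MvPolynomial (Fin 3) ℂ) (v : Fin 3 → ℂ) : Fin 3 → ℂ :=
  fun i => eval v (pderiv i F)

/-- Hessian matrix of second partial derivatives of F at v -/
def hess (F : MvPolynomial (Fin 3) ℂ) (v : Fin 3 → ℂ) : Matrix (Fin 3) (Fin 3) ℂ :=
  fun i j => eval v (pderiv i (pderiv j F))

/-- P is a node of the curve V(F): P is a singular point and the Hessian of F at
(every) representative vector of P has rank 2 -/
def IsNode (F : MvPolynomial (Fin 3) ℂ) (P : P2) : Prop :=
  P ∈ SingLoc F ∧ ∀ (v : Fin 3 → ℂ) (h : v ≠ 0), Projectivization.mk ℂ v h = P →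
    (hess F v).rank = 2

/-- The homogenized plane cubic `y² = x³ - 3x + 2e`; it is nodal when `e = 1` or `e = -1`. -/
def nodalCubic (e : ℂ) : MvPolynomial (Fin 3) ℂ :=
  X 0 ^ 3 - C 3 * (X 0 * X 2 ^ 2) + C (2 * e) * X 2 ^ 3 - X 1 ^ 2 * X 2

lemma nodalCubic_isHomogeneous (e : ℂ) : (nodalCubic e).IsHomogeneous 3 := by
  unfold nodalCubic
  refine ((IsHomogeneous.sub ?_ ?_).add ?_).sub ?_
  · exact isHomogeneous_X_pow 0 3
  · exact ((isHomogeneous_X ℂ 0).mul (isHomogeneous_X_pow 2 2)).C_mul 3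
  · exact (isHomogeneous_X_pow 2 3).C_mul _
  · exact (isHomogeneous_X_pow 1 2).mul (isHomogeneous_X ℂ 2)

lemma eval_nodalCubic (e : ℂ) (v : Fin 3 → ℂ) :
    eval v (nodalCubic e) =
      v 0 ^ 3 - 3 * (v 0 * v 2 ^ 2) + 2 * e * v 2 ^ 3 - v 1 ^ 2 * v 2 := by
  simp [nodalCubic]

lemma pderiv_zero_nodalCubic (e : ℂ) :
    pderiv 0 (nodalCubic e) = C 3 * X 0 ^ 2 - C 3 * X 2 ^ 2 := by
  simp [nodalCubic, pderiv_X]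
  exact (map_ofNat C 3).symm

lemma pderiv_one_nodalCubic (e : ℂ) :
    pderiv 1 (nodalCubic e) = - (C 2 * X 1 * X 2) := by
  have h : (C 2 : MvPolynomial (Fin 3) ℂ) = 2 := map_ofNat C 2
  simp [nodalCubic, pderiv_X]
  rw [h]
  ring

lemma pderiv_two_nodalCubic (e : ℂ) :
    pderiv 2 (nodalCubic e) = - (C 6 * X 0 * X 2) + C (6 * e) * X 2 ^ 2 - X 1 ^ 2 := by
  have h (n : ℕ) [n.AtLeastTwo] : (C (OfNat.ofNat n) : MvPolynomial (Fin 3) ℂ) = OfNat.ofNat n :=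
    map_ofNat C n
  simp [nodalCubic, pderiv_X]
  simp only [h]
  ring

lemma hess_nodalCubic (e : ℂ) (v : Fin 3 → ℂ) :
    hess (nodalCubic e) v = !![6 * v 0, 0, -6 * v 2; 0, -2 * v 2, -2 * v 1;
      -6 * v 2, -2 * v 1, -6 * v 0 + 12 * e * v 2] := by
  ext i j
  fin_cases i <;> fin_cases j <;>
    simp [hess, pderiv_zero_nodalCubic, pderiv_one_nodalCubic, pderiv_two_nodalCubic,
      pderiv_X] <;> ring

lemma nodalCubic_irreducible (e : ℂ) : Irreducible (nodalCubic e) := by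
  have hz : Prime (X 1 : MvPolynomial (Fin 2) ℂ) := X_prime
  obtain ⟨b, hb⟩ : ∃ b : MvPolynomial (Fin 2) ℂ, b = C 3 * X 1 ^ 2 := ⟨_, rfl⟩
  obtain ⟨c, hc⟩ : ∃ c : MvPolynomial (Fin 2) ℂ, c = X 1 * (C (2 * e) * X 1 ^ 2 - X 0 ^ 2) :=
    ⟨_, rfl⟩
  set p : Polynomial (MvPolynomial (Fin 2) ℂ) :=
    Polynomial.X ^ 3 + (- Polynomial.C b * Polynomial.X + Polynomial.C c) with hp
  have h : finSuccEquiv ℂ 2 (nodalCubic e) = p := by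
    have h1 : (1 : Fin 3) = Fin.succ 0 := rfl
    have h2 : (2 : Fin 3) = Fin.succ 1 := rfl
    have hC (a : ℂ) : finSuccEquiv ℂ 2 (C a) = Polynomial.C (C a) := by
      simp [finSuccEquiv_apply]
    simp only [nodalCubic, h1, h2, map_sub, map_add, map_mul, map_pow, hC, finSuccEquiv_X_zero,
      finSuccEquiv_X_succ, hp, hb, hc]
    ring
  have hlow : (- Polynomial.C b * Polynomial.X + Polynomial.C c).degree < 3 := by
    compute_degree!
  have hdeg : p.natDegree = 3 := by
    rw [hp]; compute_degree!
  have hmonic : p.Monic := Polynomial.monic_X_pow_add (by exact_mod_cast hlow)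
  rw [← MulEquiv.irreducible_iff (finSuccEquiv ℂ 2), h]
  refine Polynomial.IsEisensteinAt.irreducible (𝓟 := Ideal.span {X 1}) ⟨?_, ?_, ?_⟩
    ((Ideal.span_singleton_prime hz.ne_zero).2 hz) hmonic.isPrimitive (by omega)
  · rw [hmonic.leadingCoeff, Ideal.mem_span_singleton]
    exact fun h => hz.not_isUnit (isUnit_of_dvd_one h)
  · intro n hn
    rw [hdeg] at hn
    rw [Ideal.mem_span_singleton]
    interval_cases n
    · exact ⟨C (2 * e) * X 1 ^ 2 - X 0 ^ 2, by simpa [hp] using hc⟩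
    · exact ⟨- (C 3 * X 1), by simp [hp, Polynomial.coeff_X_pow, Polynomial.coeff_C]; rw [hb]; ring⟩
    · exact ⟨0, by simp [hp, Polynomial.coeff_X_pow]⟩
  · rw [Ideal.span_singleton_pow, Ideal.mem_span_singleton]
    rw [show p.coeff 0 = c by simp [hp], hc, pow_two (X 1 : MvPolynomial (Fin 2) ℂ),
      mul_dvd_mul_iff_left hz.ne_zero]
    rintro ⟨q, hq⟩
    have hd : (X 1 : MvPolynomial (Fin 2) ℂ) ∣ X 0 ^ 2 :=
      ⟨C (2 * e) * X 1 - q, by linear_combination -hq⟩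
    simpa using X_dvd_X.1 (hz.dvd_of_dvd_pow hd)

/-- Every representative of a singular point of `nodalCubic e` is a multiple of `(e, 0, 1)`. -/
lemma eval_pderiv_nodalCubic_eq_zero_iff {e : ℂ} (he : e ^ 2 = 1) (v : Fin 3 → ℂ) :
    (∀ i, eval v (pderiv i (nodalCubic e)) = 0) ↔ v = v 2 • ![e, 0, 1] := by
  constructor
  · intro h
    have h0 := h 0
    have h1 := h 1
    have h2 := h 2
    simp only [pderiv_zero_nodalCubic, pderiv_one_nodalCubic, pderiv_two_nodalCubic, map_sub,
      map_add, map_neg, map_mul, map_pow, eval_X, eval_C] at h0 h1 h2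
    have hx : v 0 ^ 2 = v 2 ^ 2 := by linear_combination h0 / 3
    have hy : v 1 = 0 := by
      rcases mul_eq_zero.1 (show v 1 * v 2 = 0 by linear_combination -h1 / 2) with hy | hz
      · exact hy
      · exact pow_eq_zero_iff two_ne_zero |>.1 (by rw [hz] at h2; linear_combination -h2)
    have hxz : v 0 = v 2 * e := by
      rcases mul_eq_zero.1 (show v 2 * (v 0 - v 2 * e) = 0 by
        rw [hy] at h2; linear_combination -h2 / 6) with hz | hz
      · rw [hz] at hx ⊢
        simpa using hx
      · exact sub_eq_zero.1 hz
    ext i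
    fin_cases i <;> simp [hy, hxz]
  · intro h i
    have h0 : v 0 = v 2 * e := by simpa using congrFun h 0
    have h1 : v 1 = 0 := by simpa using congrFun h 1
    fin_cases i <;>
      simp only [Fin.zero_eta, Fin.mk_one, Fin.reduceFinMk, pderiv_zero_nodalCubic,
        pderiv_one_nodalCubic, pderiv_two_nodalCubic, map_sub,
        map_add, map_neg, map_mul, map_pow, eval_X, eval_C, h0, h1]
    · linear_combination 3 * v 2 ^ 2 * he
    · ring
    · ring

lemma node_ne_zero (e : ℂ) : (![e, 0, 1] : Fin 3 → ℂ) ≠ 0 := fun h => by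
  simpa using congrFun h 2

lemma singLoc_nodalCubic {e : ℂ} (he : e ^ 2 = 1) :
    SingLoc (nodalCubic e) = {Projectivization.mk ℂ ![e, 0, 1] (node_ne_zero e)} := by
  ext P
  induction P using Projectivization.ind with | h v hv => ?_
  simp only [SingLoc, eval_pderiv_nodalCubic_eq_zero_iff he, Set.mem_ofPred_eq, Set.mem_singleton_iff]
  constructor
  · intro h
    exact (Projectivization.mk_eq_mk_iff' ℂ _ _ _ _).2 ⟨v 2, (h v hv rfl).symm⟩
  · intro h w hw hwv
    obtain ⟨a, rfl⟩ := (Projectivization.mk_eq_mk_iff' ℂ _ _ _ _).1 (hwv.trans h)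
    simp

lemma hess_nodalCubic_rank {e : ℂ} (he : e ^ 2 = 1) {t : ℂ} (ht : t ≠ 0) :
    (hess (nodalCubic e) (t • ![e, 0, 1])).rank = 2 := by
  have he0 : e ≠ 0 := by rintro rfl; simp at he
  set A := hess (nodalCubic e) (t • ![e, 0, 1]) with hA
  rw [hess_nodalCubic] at hA
  apply le_antisymm
  · have hfac : A = !![6 * e * t, 0; 0, -2 * t; -6 * t, 0] * !![1, 0, -e; 0, 1, 0] := by
      rw [hA]
      ext i j
      fin_cases i <;> fin_cases j <;> simp [Matrix.mul_apply, Fin.sum_univ_two]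
      · ring
      · linear_combination -6 * t * he
      · ring
    rw [hfac]
    exact (Matrix.rank_mul_le_left _ _).trans (Matrix.rank_le_width _)
  · have hdet : (A.submatrix (![0, 1] : Fin 2 → Fin 3) ![0, 1]).det ≠ 0 := by
      rw [Matrix.det_fin_two, hA]
      simp [he0, ht]
    exact (Matrix.rank_of_det_ne_zero hdet).ge.trans (Matrix.rank_submatrix_le A _ _)

lemma isNode_nodalCubic {e : ℂ} (he : e ^ 2 = 1) :
    IsNode (nodalCubic e) (Projectivization.mk ℂ ![e, 0, 1] (node_ne_zero e)) := by
  refine ⟨by simp [singLoc_nodalCubic he], fun v hv h => ?_⟩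
  obtain ⟨t, rfl⟩ := (Projectivization.mk_eq_mk_iff' ℂ _ _ _ _).1 h
  exact hess_nodalCubic_rank he (by rintro rfl; simp at hv)

lemma flex_ne_zero : (![0, 1, 0] : Fin 3 → ℂ) ≠ 0 := fun h => by
  simpa using congrFun h 1

lemma flex_ne_node (e : ℂ) : Projectivization.mk ℂ ![0, 1, 0] flex_ne_zero ≠
    Projectivization.mk ℂ ![e, 0, 1] (node_ne_zero e) := fun h => by
  obtain ⟨a, ha⟩ := (Projectivization.mk_eq_mk_iff' ℂ _ _ _ _).1 h
  simpa using congrFun ha 1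

lemma VV_nodalCubic_inter {e e' : ℂ} (h : e ≠ e') :
    VV (nodalCubic e) ∩ VV (nodalCubic e') = {Projectivization.mk ℂ ![0, 1, 0] flex_ne_zero} := by
  ext P
  induction P using Projectivization.ind with | h v hv => ?_
  simp only [VV, eval_nodalCubic, Set.mem_inter_iff, Set.mem_ofPred_eq, Set.mem_singleton_iff]
  constructor
  · rintro ⟨h1, h2⟩
    specialize h1 v hv rfl
    specialize h2 v hv rfl
    have hz : v 2 = 0 := by
      have : (e - e') * v 2 ^ 3 = 0 := by linear_combination (h1 - h2) / 2
      simpa [sub_ne_zero.2 h] using this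
    have hx : v 0 = 0 := by simpa [hz] using h1
    refine (Projectivization.mk_eq_mk_iff' ℂ _ _ _ _).2 ⟨v 1, ?_⟩
    ext i
    fin_cases i <;> simp [hx, hz]
  · intro hP
    constructor <;>
    · intro w hw hwv
      obtain ⟨a, rfl⟩ := (Projectivization.mk_eq_mk_iff' ℂ _ _ _ _).1 (hwv.trans hP)
      simp

/-- There exist two irreducible homogeneous cubics F, G whose curves are nodal cubics
(exactly one singular point, a node), intersecting in exactly one point P of ℙ²,
with P distinct from both nodes (hence a smooth point of both cubics). -/
theorem stmt_17 :
    ∃ (F G : MvPolynomial (Fin 3) ℂ) (NF NG P : P2),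
      F.IsHomogeneous 3 ∧ G.IsHomogeneous 3 ∧ Irreducible F ∧ Irreducible G ∧
      SingLoc F = {NF} ∧ IsNode F NF ∧
      SingLoc G = {NG} ∧ IsNode G NG ∧
      VV F ∩ VV G = {P} ∧ P ≠ NF ∧ P ≠ NG := by
  have h1 : (1 : ℂ) ^ 2 = 1 := by norm_num
  have h2 : (-1 : ℂ) ^ 2 = 1 := by norm_num
  exact ⟨nodalCubic 1, nodalCubic (-1), _, _, _, nodalCubic_isHomogeneous _,
    nodalCubic_isHomogeneous _, nodalCubic_irreducible _, nodalCubic_irreducible _,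
    singLoc_nodalCubic h1, isNode_nodalCubic h1, singLoc_nodalCubic h2, isNode_nodalCubic h2,
    VV_nodalCubic_inter (by norm_num), flex_ne_node _, flex_ne_node _⟩
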